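/- arXiv:1911.04568 — 2 statements merged into one kernel-verified Lean document; each statement's English description precedes it below -/
import Mathlib

section
/- Let κ be a regular uncountable cardinal and let U be a κ-complete nonprincipal ultrafilter on κ. Let x₁ = (c₁, A₁) and x₂ = (c₂, A₂) be conditions of the club-shooting poset C_U, and let ν ∈ A₁ ∩ A₂ be any ordinal with ν > max(c₁) and ν > max(c₂) (such ν exists since A₁ ∩ A₂ ∈ U is unbounded). Set y₁ = (c₁ ∪ {ν}, (A₁ ∩ A₂) \ (ν+1)) and y₂ = (c₂ ∪ {ν}, (A₁ ∩ A₂) \ (ν+1)). Then y₁ extends x₁, y₂ extends x₂, and the map σ sending (c, A) to (c₂ ∪ {ξ ∈ c : ξ ≥ ν}, A) is an order isomorphism from the cone {z ∈ C_U : z ≥ y₁} onto the cone {z ∈ C_U : z ≥ y₂}, with inverse given by (c, A) ↦ (c₁ ∪ {ξ ∈ c : ξ ≥ ν}, A). In particular, C_U is cone homogeneous. -/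
/-- A condition of the club-shooting poset `C_F` for a family `F` of subsets of `κ`:
a pair `(c, A)` where `c` is a nonempty bounded closed subset of `κ` and `A ∈ F`. -/
def IsCond (κ : Ordinal) (F : Set (Set Ordinal)) (p : Set Ordinal × Set Ordinal) : Prop :=
  p.1.Nonempty ∧ p.1 ⊆ Set.Iio κ ∧ sSup p.1 < κ ∧
    (∀ s ⊆ p.1, s.Nonempty → sSup s ∈ p.1) ∧ p.2 ∈ F

/-- `CondExt p q` : the condition `q` extends the condition `p`, i.e. `q.1 ∩ (max p.1 + 1) = p.1`,
`q.2 ⊆ p.2` and `q.1 \ p.1 ⊆ p.2`. -/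
def CondExt (p q : Set Ordinal × Set Ordinal) : Prop :=
  q.1 ∩ Set.Iic (sSup p.1) = p.1 ∧ q.2 ⊆ p.2 ∧ q.1 \ p.1 ⊆ p.2

/-- Cone homogeneity of the club-shooting poset `C_F`. -/
def ConeHomogeneous (κ : Ordinal) (F : Set (Set Ordinal)) : Prop :=
  ∀ p q : Set Ordinal × Set Ordinal, IsCond κ F p → IsCond κ F q →
    ∃ p' q', IsCond κ F p' ∧ IsCond κ F q' ∧ CondExt p p' ∧ CondExt q q' ∧
      ∃ e : {z : Set Ordinal × Set Ordinal // IsCond κ F z ∧ CondExt p' z} ≃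
            {z : Set Ordinal × Set Ordinal // IsCond κ F z ∧ CondExt q' z},
        ∀ a b, CondExt a.1 b.1 ↔ CondExt (e a).1 (e b).1

/-- The cone map `σ` sending `(c, A)` to `(c₀ ∪ {ξ ∈ c : ξ ≥ ν}, A)`. -/
def coneMap (c₀ : Set Ordinal) (ν : Ordinal) (p : Set Ordinal × Set Ordinal) :
    Set Ordinal × Set Ordinal :=
  (c₀ ∪ {ξ ∈ p.1 | ν ≤ ξ}, p.2)

lemma IsCond.bddAbove {κ : Ordinal} {F : Set (Set Ordinal)} {p : Set Ordinal × Set Ordinal}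
    (h : IsCond κ F p) : BddAbove p.1 :=
  ⟨κ, fun _ hx => (h.2.1 hx).le⟩

lemma IsCond.isGreatest {κ : Ordinal} {F : Set (Set Ordinal)} {p : Set Ordinal × Set Ordinal}
    (h : IsCond κ F p) : IsGreatest p.1 (sSup p.1) :=
  ⟨h.2.2.2.1 p.1 subset_rfl h.1, fun _ hx => le_csSup h.bddAbove hx⟩

lemma isCond_singleton {κ ν : Ordinal} {F : Set (Set Ordinal)} {A : Set Ordinal}
    (hν : ν < κ) (hA : A ∈ F) : IsCond κ F ({ν}, A) := by
  refine ⟨Set.singleton_nonempty ν, by simpa using hν, by simpa using hν, fun s hs hne => ?_, hA⟩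
  rw [(Set.Nonempty.subset_singleton_iff hne).1 hs]
  simp

lemma isGreatest_union_singleton {c : Set Ordinal} {ν : Ordinal} (hc : ∀ x ∈ c, x < ν) :
    IsGreatest (c ∪ {ν}) ν :=
  ⟨Or.inr rfl, by rintro x (hx | rfl); exacts [(hc x hx).le, le_rfl]⟩

lemma sSup_union_singleton {c : Set Ordinal} {ν : Ordinal} (hc : ∀ x ∈ c, x < ν) :
    sSup (c ∪ {ν}) = ν :=
  (isGreatest_union_singleton hc).csSup_eq

lemma isGreatest_coneMap {κ ν : Ordinal} {F : Set (Set Ordinal)} {c : Set Ordinal}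
    {p : Set Ordinal × Set Ordinal} (hc : ∀ x ∈ c, x < ν) (hp : IsCond κ F p) (hν : ν ∈ p.1) :
    IsGreatest (coneMap c ν p).1 (sSup p.1) := by
  have hmax := hp.isGreatest
  refine ⟨Or.inr ⟨hmax.1, hmax.2 hν⟩, ?_⟩
  rintro x (hx | hx)
  exacts [(hc x hx).le.trans (hmax.2 hν), hmax.2 hx.1]

lemma isCond_coneMap {κ ν : Ordinal} {F : Set (Set Ordinal)} {c A : Set Ordinal}
    {p : Set Ordinal × Set Ordinal} (hcond : IsCond κ F (c, A)) (hc : ∀ x ∈ c, x < ν)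
    (hp : IsCond κ F p) (hν : ν ∈ p.1) : IsCond κ F (coneMap c ν p) := by
  have hg := isGreatest_coneMap hc hp hν
  refine ⟨⟨_, hg.1⟩, ?_, by rw [hg.csSup_eq]; exact hp.2.2.1, fun s hs hne => ?_, hp.2.2.2.2⟩
  · rintro x (hx | hx)
    exacts [hcond.2.1 hx, hp.2.1 hx.1]
  · have hbdd : BddAbove s := ⟨_, fun x hx => hg.2 (hs hx)⟩
    by_cases h : (s ∩ Set.Ici ν).Nonempty
    · have hsub : s ∩ Set.Ici ν ⊆ p.1 := by
        rintro x ⟨hx, hxν⟩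
        rcases hs hx with hx' | hx'
        exacts [absurd (hc x hx') (not_lt.2 hxν), hx'.1]
      have hbdd' : BddAbove (s ∩ Set.Ici ν) := hbdd.mono Set.inter_subset_left
      obtain ⟨y, hy⟩ := h
      have hle : ν ≤ sSup (s ∩ Set.Ici ν) := le_csSup_of_le hbdd' hy hy.2
      have heq : sSup s = sSup (s ∩ Set.Ici ν) := by
        refine le_antisymm (csSup_le hne fun x hx => ?_)
          (csSup_le_csSup hbdd ⟨y, hy⟩ Set.inter_subset_left)
        rcases le_or_gt ν x with hx' | hx'
        exacts [le_csSup hbdd' ⟨hx, hx'⟩, hx'.le.trans hle]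
      rw [heq]
      exact Or.inr ⟨hp.2.2.2.1 _ hsub ⟨y, hy⟩, hle⟩
    · refine Or.inl (hcond.2.2.2.1 s (fun x hx => ?_) hne)
      rcases hs hx with hx' | hx'
      exacts [hx', absurd ⟨x, hx, hx'.2⟩ h]

lemma coneMap_singleton (c A : Set Ordinal) (ν : Ordinal) :
    coneMap c ν ({ν}, A) = (c ∪ {ν}, A) := by
  ext x
  · simp only [coneMap, Set.mem_union, Set.mem_ofPred_eq, Set.mem_singleton_iff]
    grind
  · rfl

lemma isCond_union_singleton {κ ν : Ordinal} {F : Set (Set Ordinal)} {c A B : Set Ordinal}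
    (hcond : IsCond κ F (c, A)) (hc : ∀ x ∈ c, x < ν) (hν : ν < κ) (hB : B ∈ F) :
    IsCond κ F (c ∪ {ν}, B) := by
  rw [← coneMap_singleton]
  exact isCond_coneMap hcond hc (isCond_singleton hν hB) rfl

lemma condExt_union_singleton {κ ν : Ordinal} {F : Set (Set Ordinal)} {c A B : Set Ordinal}
    (hcond : IsCond κ F (c, A)) (hc : sSup c < ν) (hν : ν ∈ A) (hB : B ⊆ A) :
    CondExt (c, A) (c ∪ {ν}, B) := by
  have hmax := hcond.isGreatest
  refine ⟨?_, hB, ?_⟩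
  · ext x
    constructor
    · rintro ⟨hx | rfl, hx'⟩
      exacts [hx, absurd hc (not_lt.2 hx')]
    · exact fun hx => ⟨Or.inl hx, hmax.2 hx⟩
  · rintro x ⟨hx | rfl, hx'⟩
    exacts [absurd hx hx', hν]

lemma condExt_union_singleton_iff {ν : Ordinal} {c B : Set Ordinal}
    {p : Set Ordinal × Set Ordinal} (hc : ∀ x ∈ c, x < ν) :
    CondExt (c ∪ {ν}, B) p ↔
      (∀ x < ν, x ∈ p.1 ↔ x ∈ c) ∧ ν ∈ p.1 ∧ p.2 ⊆ B ∧ ∀ x ∈ p.1, ν < x → x ∈ B := by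
  simp only [CondExt, sSup_union_singleton hc, Set.ext_iff, Set.subset_def, Set.mem_inter_iff,
    Set.mem_Iic, Set.mem_union, Set.mem_singleton_iff, Set.mem_sdiff]
  constructor
  · rintro ⟨h, h', h''⟩
    refine ⟨fun x hx => ?_, ((h ν).2 (Or.inr rfl)).1, h', fun x hx hx' => ?_⟩
    · simpa [hx.le, hx.ne] using h x
    · refine h'' x ⟨hx, ?_⟩
      rintro (h | h)
      exacts [(hc x h).not_gt hx', hx'.ne' h]
  · rintro ⟨h, h', h'', h'''⟩
    refine ⟨fun x => ?_, h'', fun x hx => ?_⟩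
    · rcases lt_trichotomy x ν with hx | rfl | hx
      · simpa [hx.le, hx.ne] using h x hx
      · simpa using h'
      · simpa [hx.not_ge, hx.ne'] using fun h => (hc x h).not_gt hx
    · refine h''' x hx.1 ?_
      by_contra hlt
      rcases (not_lt.1 hlt).lt_or_eq with hxν | hxν
      exacts [hx.2 (Or.inl ((h x hxν).1 hx.1)), hx.2 (Or.inr hxν)]

lemma mem_coneMap_of_lt {c : Set Ordinal} {ν x : Ordinal} (p : Set Ordinal × Set Ordinal)
    (hx : x < ν) : x ∈ (coneMap c ν p).1 ↔ x ∈ c := by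
  simp [coneMap, hx.not_ge]

lemma mem_coneMap_of_le {c : Set Ordinal} {ν x : Ordinal} (hc : ∀ x ∈ c, x < ν)
    (p : Set Ordinal × Set Ordinal) (hx : ν ≤ x) : x ∈ (coneMap c ν p).1 ↔ x ∈ p.1 := by
  have : x ∉ c := fun h => (hc x h).not_ge hx
  simp [coneMap, hx, this]

lemma condExt_coneMap {ν : Ordinal} {c c' B : Set Ordinal} {p : Set Ordinal × Set Ordinal}
    (hc : ∀ x ∈ c, x < ν) (hc' : ∀ x ∈ c', x < ν) (h : CondExt (c ∪ {ν}, B) p) :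
    CondExt (c' ∪ {ν}, B) (coneMap c' ν p) := by
  rw [condExt_union_singleton_iff hc] at h
  rw [condExt_union_singleton_iff hc']
  exact ⟨fun x hx => mem_coneMap_of_lt p hx, (mem_coneMap_of_le hc' p le_rfl).2 h.2.1, h.2.2.1,
    fun x hx hx' => h.2.2.2 x ((mem_coneMap_of_le hc' p hx'.le).1 hx) hx'⟩

lemma coneMap_coneMap {ν : Ordinal} {c c' B : Set Ordinal} {p : Set Ordinal × Set Ordinal}
    (hc : ∀ x ∈ c, x < ν) (hc' : ∀ x ∈ c', x < ν) (h : CondExt (c ∪ {ν}, B) p) :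
    coneMap c ν (coneMap c' ν p) = p := by
  rw [condExt_union_singleton_iff hc] at h
  refine Prod.ext (Set.ext fun x => ?_) rfl
  rcases lt_or_ge x ν with hx | hx
  · rw [mem_coneMap_of_lt _ hx, h.1 x hx]
  · rw [mem_coneMap_of_le hc _ hx, mem_coneMap_of_le hc' _ hx]

lemma CondExt.coneMap {κ ν : Ordinal} {F : Set (Set Ordinal)} {c : Set Ordinal}
    {p q : Set Ordinal × Set Ordinal} (hc : ∀ x ∈ c, x < ν) (hp : IsCond κ F p) (hν : ν ∈ p.1)
    (h : CondExt p q) : CondExt (coneMap c ν p) (coneMap c ν q) := by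
  have hνle : ν ≤ sSup p.1 := hp.isGreatest.2 hν
  refine ⟨?_, h.2.1, ?_⟩
  · rw [(isGreatest_coneMap hc hp hν).csSup_eq]
    ext x
    have hx := Set.ext_iff.1 h.1 x
    simp only [Set.mem_inter_iff, Set.mem_Iic] at hx ⊢
    rcases lt_or_ge x ν with hxν | hxν
    · simp [mem_coneMap_of_lt _ hxν, hxν.le.trans hνle]
    · rw [mem_coneMap_of_le hc _ hxν, mem_coneMap_of_le hc _ hxν, hx]
  · rintro x ⟨hxq, hxp⟩
    rcases lt_or_ge x ν with hxν | hxν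
    · rw [mem_coneMap_of_lt _ hxν] at hxq hxp
      exact absurd hxq hxp
    · rw [mem_coneMap_of_le hc _ hxν] at hxq hxp
      exact h.2.2 ⟨hxq, hxp⟩

lemma condExt_iff_condExt_coneMap {κ ν : Ordinal} {F : Set (Set Ordinal)} {c c' A' B : Set Ordinal}
    {p q : Set Ordinal × Set Ordinal} (hc : ∀ x ∈ c, x < ν) (hc' : ∀ x ∈ c', x < ν)
    (hcond' : IsCond κ F (c', A')) (hp : IsCond κ F p)
    (hep : CondExt (c ∪ {ν}, B) p) (heq : CondExt (c ∪ {ν}, B) q) :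
    CondExt p q ↔ CondExt (coneMap c' ν p) (coneMap c' ν q) := by
  have hν : ν ∈ p.1 := ((condExt_union_singleton_iff hc).1 hep).2.1
  refine ⟨CondExt.coneMap hc' hp hν, fun h => ?_⟩
  have h' := h.coneMap hc (isCond_coneMap hcond' hc' hp hν)
    ((mem_coneMap_of_le hc' p le_rfl).2 hν)
  rwa [coneMap_coneMap hc hc' hep, coneMap_coneMap hc hc' heq] at h'

lemma inter_mem_of_complete {κ : Ordinal} {U : Set (Set Ordinal)} (hκ : 2 < κ)
    (hUsub : ∀ A ∈ U, A ⊆ Set.Iio κ)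
    (hUcomplete : ∀ η < κ, ∀ A : Ordinal → Set Ordinal,
      (∀ i < η, A i ∈ U) → (Set.Iio κ ∩ ⋂ i ∈ Set.Iio η, A i) ∈ U)
    {A B : Set Ordinal} (hA : A ∈ U) (hB : B ∈ U) : A ∩ B ∈ U := by
  classical
  have h := hUcomplete 2 hκ (fun i => if i = 0 then A else B)
    (fun i _ => by split_ifs; exacts [hA, hB])
  convert h using 1
  ext x
  simp only [Set.mem_inter_iff, Set.mem_iInter, Set.mem_Iio]
  constructor
  · rintro ⟨hxA, hxB⟩
    refine ⟨hUsub A hA hxA, fun i _ => ?_⟩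
    split_ifs
    exacts [hxA, hxB]
  · rintro ⟨-, hx⟩
    exact ⟨by simpa using hx 0 (by simp), by simpa using hx 1 one_lt_two⟩

lemma diff_Iic_mem_of_complete {κ ν : Ordinal} {U : Set (Set Ordinal)} (hκ : 2 < κ)
    (hUsub : ∀ A ∈ U, A ⊆ Set.Iio κ)
    (hUult : ∀ A ⊆ Set.Iio κ, A ∈ U ∨ Set.Iio κ \ A ∈ U)
    (hUcomplete : ∀ η < κ, ∀ A : Ordinal → Set Ordinal,
      (∀ i < η, A i ∈ U) → (Set.Iio κ ∩ ⋂ i ∈ Set.Iio η, A i) ∈ U)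
    (hUnp : ∀ x : Ordinal, ({x} : Set Ordinal) ∉ U)
    (hν : Order.succ ν < κ) {A : Set Ordinal} (hA : A ∈ U) : A \ Set.Iic ν ∈ U := by
  have h := hUcomplete (Order.succ ν) hν (fun i => Set.Iio κ \ {i}) fun i hi =>
    (hUult {i} (Set.singleton_subset_iff.2 (hi.trans hν))).resolve_left (hUnp i)
  convert inter_mem_of_complete hκ hUsub hUcomplete hA h using 1
  ext x
  simp only [Set.mem_sdiff, Set.mem_inter_iff, Set.mem_iInter, Set.mem_Iio, Set.mem_Iic,
    Order.lt_succ_iff, Set.mem_singleton_iff]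
  constructor
  · rintro ⟨hxA, hx⟩
    have hxκ := hUsub A hA hxA
    exact ⟨hxA, hxκ, fun i hi => ⟨hxκ, fun h => hx (h ▸ hi)⟩⟩
  · rintro ⟨hxA, -, hx⟩
    exact ⟨hxA, fun h => (hx x h).2 rfl⟩

/-- The map `coneMap` as a bijection between two cones. -/
def coneEquiv {κ ν : Ordinal} {F : Set (Set Ordinal)} {c c' A A' B : Set Ordinal}
    (hcond : IsCond κ F (c, A)) (hcond' : IsCond κ F (c', A'))
    (hc : ∀ x ∈ c, x < ν) (hc' : ∀ x ∈ c', x < ν) :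
    {z : Set Ordinal × Set Ordinal // IsCond κ F z ∧ CondExt (c ∪ {ν}, B) z} ≃
      {z : Set Ordinal × Set Ordinal // IsCond κ F z ∧ CondExt (c' ∪ {ν}, B) z} where
  toFun z := ⟨coneMap c' ν z.1, isCond_coneMap hcond' hc' z.2.1
    ((condExt_union_singleton_iff hc).1 z.2.2).2.1, condExt_coneMap hc hc' z.2.2⟩
  invFun z := ⟨coneMap c ν z.1, isCond_coneMap hcond hc z.2.1
    ((condExt_union_singleton_iff hc').1 z.2.2).2.1, condExt_coneMap hc' hc z.2.2⟩
  left_inv z := Subtype.ext (coneMap_coneMap hc hc' z.2.2)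
  right_inv z := Subtype.ext (coneMap_coneMap hc' hc z.2.2)

lemma coneHomogeneous_of_unbounded {κ : Ordinal} {F : Set (Set Ordinal)}
    (hsub : ∀ A ∈ F, A ⊆ Set.Iio κ)
    (hinter : ∀ A ∈ F, ∀ B ∈ F, A ∩ B ∈ F)
    (hdiff : ∀ A ∈ F, ∀ ν < κ, A \ Set.Iic ν ∈ F) (hempty : ∅ ∉ F) :
    ConeHomogeneous κ F := by
  rintro ⟨c, A⟩ ⟨c', A'⟩ hp hq
  have hAA' := hinter A hp.2.2.2.2 A' hq.2.2.2.2
  obtain ⟨ν, hν, hνmax⟩ : ((A ∩ A') \ Set.Iic (max (sSup c) (sSup c'))).Nonempty := by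
    rw [Set.nonempty_iff_ne_empty]
    intro h
    exact hempty (h ▸ hdiff _ hAA' _ (max_lt hp.2.2.1 hq.2.2.1))
  obtain ⟨hν₁, hν₂⟩ := max_lt_iff.1 (not_le.1 (Set.mem_Iic.not.1 hνmax))
  have hc : ∀ x ∈ c, x < ν := fun x hx => (hp.isGreatest.2 hx).trans_lt hν₁
  have hc' : ∀ x ∈ c', x < ν := fun x hx => (hq.isGreatest.2 hx).trans_lt hν₂
  have hνκ : ν < κ := hsub _ hAA' hν
  have hB := hdiff _ hAA' ν hνκ
  exact ⟨(c ∪ {ν}, (A ∩ A') \ Set.Iic ν), (c' ∪ {ν}, (A ∩ A') \ Set.Iic ν),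
    isCond_union_singleton hp hc hνκ hB, isCond_union_singleton hq hc' hνκ hB,
    condExt_union_singleton hp hν₁ hν.1 (Set.sdiff_subset.trans Set.inter_subset_left),
    condExt_union_singleton hq hν₂ hν.2 (Set.sdiff_subset.trans Set.inter_subset_right),
    coneEquiv hp hq hc hc',
    fun a b => condExt_iff_condExt_coneMap hc hc' hq a.2.1 a.2.2 b.2.2⟩

/-- For a κ-complete nonprincipal ultrafilter `U` on a regular uncountable cardinal `κ`,
given conditions `x₁ = (c₁, A₁)`, `x₂ = (c₂, A₂)` of `C_U` and `ν ∈ A₁ ∩ A₂` above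
`max c₁, max c₂`, the conditions `y₁ = (c₁ ∪ {ν}, (A₁ ∩ A₂) \ (ν+1))` and
`y₂ = (c₂ ∪ {ν}, (A₁ ∩ A₂) \ (ν+1))` extend `x₁`, `x₂` respectively, and
`σ : (c, A) ↦ (c₂ ∪ {ξ ∈ c : ξ ≥ ν}, A)` is an order isomorphism from the cone above `y₁`
onto the cone above `y₂`, with inverse `(c, A) ↦ (c₁ ∪ {ξ ∈ c : ξ ≥ ν}, A)`.
In particular, `C_U` is cone homogeneous. -/
theorem clubShooting_ultrafilter_cone_iso
    (κ : Ordinal) (hcard : κ.card.ord = κ) (hreg : κ.card.IsRegular)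
    (hunc : Cardinal.aleph0 < κ.card)
    (U : Set (Set Ordinal))
    (hUsub : ∀ A ∈ U, A ⊆ Set.Iio κ)
    (hUuniv : Set.Iio κ ∈ U)
    (hUup : ∀ A ∈ U, ∀ B, A ⊆ B → B ⊆ Set.Iio κ → B ∈ U)
    (hUproper : (∅ : Set Ordinal) ∉ U)
    (hUult : ∀ A ⊆ Set.Iio κ, A ∈ U ∨ Set.Iio κ \ A ∈ U)
    (hUcomplete : ∀ η < κ, ∀ A : Ordinal → Set Ordinal,
      (∀ i < η, A i ∈ U) → (Set.Iio κ ∩ ⋂ i ∈ Set.Iio η, A i) ∈ U)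
    (hUnp : ∀ x : Ordinal, ({x} : Set Ordinal) ∉ U)
    (c₁ A₁ c₂ A₂ : Set Ordinal)
    (h₁ : IsCond κ U (c₁, A₁)) (h₂ : IsCond κ U (c₂, A₂))
    (ν : Ordinal) (hν : ν ∈ A₁ ∩ A₂) (hν₁ : sSup c₁ < ν) (hν₂ : sSup c₂ < ν) :
    IsCond κ U (c₁ ∪ {ν}, (A₁ ∩ A₂) \ Set.Iic ν) ∧
    IsCond κ U (c₂ ∪ {ν}, (A₁ ∩ A₂) \ Set.Iic ν) ∧
    CondExt (c₁, A₁) (c₁ ∪ {ν}, (A₁ ∩ A₂) \ Set.Iic ν) ∧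
    CondExt (c₂, A₂) (c₂ ∪ {ν}, (A₁ ∩ A₂) \ Set.Iic ν) ∧
    (∀ p, IsCond κ U p → CondExt (c₁ ∪ {ν}, (A₁ ∩ A₂) \ Set.Iic ν) p →
      IsCond κ U (coneMap c₂ ν p) ∧
        CondExt (c₂ ∪ {ν}, (A₁ ∩ A₂) \ Set.Iic ν) (coneMap c₂ ν p)) ∧
    (∀ p, IsCond κ U p → CondExt (c₂ ∪ {ν}, (A₁ ∩ A₂) \ Set.Iic ν) p →
      IsCond κ U (coneMap c₁ ν p) ∧
        CondExt (c₁ ∪ {ν}, (A₁ ∩ A₂) \ Set.Iic ν) (coneMap c₁ ν p)) ∧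
    (∀ p, IsCond κ U p → CondExt (c₁ ∪ {ν}, (A₁ ∩ A₂) \ Set.Iic ν) p →
      coneMap c₁ ν (coneMap c₂ ν p) = p) ∧
    (∀ p, IsCond κ U p → CondExt (c₂ ∪ {ν}, (A₁ ∩ A₂) \ Set.Iic ν) p →
      coneMap c₂ ν (coneMap c₁ ν p) = p) ∧
    (∀ p q, IsCond κ U p → CondExt (c₁ ∪ {ν}, (A₁ ∩ A₂) \ Set.Iic ν) p →
      IsCond κ U q → CondExt (c₁ ∪ {ν}, (A₁ ∩ A₂) \ Set.Iic ν) q →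
      (CondExt p q ↔ CondExt (coneMap c₂ ν p) (coneMap c₂ ν q))) ∧
    ConeHomogeneous κ U := by
  have hωκ : Ordinal.omega0 < κ := by
    rw [← hcard, ← Cardinal.ord_aleph0]
    exact Cardinal.ord_lt_ord.2 hunc
  have hκ : 2 < κ := (Ordinal.natCast_lt_omega0 2).trans hωκ
  have hlim : Order.IsSuccLimit κ := hcard ▸ Cardinal.isSuccLimit_ord hreg.aleph0_le
  have hinter : ∀ A ∈ U, ∀ B ∈ U, A ∩ B ∈ U := fun A hA B hB =>
    inter_mem_of_complete hκ hUsub hUcomplete hA hB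
  have hdiff : ∀ A ∈ U, ∀ ν < κ, A \ Set.Iic ν ∈ U := fun A hA ν hν =>
    diff_Iic_mem_of_complete hκ hUsub hUult hUcomplete hUnp (hlim.succ_lt hν) hA
  have hc₁ : ∀ x ∈ c₁, x < ν := fun x hx => (h₁.isGreatest.2 hx).trans_lt hν₁
  have hc₂ : ∀ x ∈ c₂, x < ν := fun x hx => (h₂.isGreatest.2 hx).trans_lt hν₂
  have hνκ : ν < κ := hUsub _ h₁.2.2.2.2 hν.1
  have hB := hdiff _ (hinter _ h₁.2.2.2.2 _ h₂.2.2.2.2) ν hνκ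
  exact ⟨isCond_union_singleton h₁ hc₁ hνκ hB, isCond_union_singleton h₂ hc₂ hνκ hB,
    condExt_union_singleton h₁ hν₁ hν.1 (Set.sdiff_subset.trans Set.inter_subset_left),
    condExt_union_singleton h₂ hν₂ hν.2 (Set.sdiff_subset.trans Set.inter_subset_right),
    fun p hp hep => ⟨isCond_coneMap h₂ hc₂ hp ((condExt_union_singleton_iff hc₁).1 hep).2.1,
      condExt_coneMap hc₁ hc₂ hep⟩,
    fun p hp hep => ⟨isCond_coneMap h₁ hc₁ hp ((condExt_union_singleton_iff hc₂).1 hep).2.1,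
      condExt_coneMap hc₂ hc₁ hep⟩,
    fun p _ hep => coneMap_coneMap hc₁ hc₂ hep,
    fun p _ hep => coneMap_coneMap hc₂ hc₁ hep,
    fun p q hp hep _ heq => condExt_iff_condExt_coneMap hc₁ hc₂ h₂ hp hep heq,
    coneHomogeneous_of_unbounded hUsub hinter hdiff hUproper⟩
end

section
/- Let κ be a regular uncountable cardinal such that 2^λ ≤ κ for every cardinal λ < κ, and let F be a proper filter on κ. Then any two conditions of the club-shooting poset C_F having the same closed bounded part are compatible (have a common extension), and consequently every antichain (pairwise incompatible set of conditions) of C_F has cardinality at most κ; that is, C_F satisfies the κ⁺-chain condition. -/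
theorem exists_injective_set_Iic {κ α : Ordinal} (hcard : κ.card.ord = κ)
    (hinf : Cardinal.aleph0 ≤ κ.card)
    (hpow : ∀ lam : Cardinal, lam < κ.card → 2 ^ lam ≤ κ.card) (hα : α < κ) :
    ∃ f : Set (Set.Iic α) → Set.Iio κ, Function.Injective f := by
  have hsucc : Order.succ α < κ := by
    rw [← hcard] at hα ⊢
    exact (Cardinal.isSuccLimit_ord hinf).succ_lt hα
  have hlt : (Order.succ α).card < κ.card := by
    rw [← hcard] at hsucc
    exact Cardinal.lt_ord.1 hsucc
  have hle : Cardinal.mk (Set (Set.Iic α)) ≤ Cardinal.mk (Set.Iio κ) := by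
    rw [Cardinal.mk_set, ← Order.Iio_succ, Cardinal.mk_Iio_ordinal, Cardinal.mk_Iio_ordinal,
      ← Cardinal.lift_two_power, Cardinal.lift_le]
    exact hpow _ hlt
  obtain ⟨f⟩ := hle
  exact ⟨f, f.injective⟩

theorem IsCond.subset_Iic_sSup {κ : Ordinal} {F : Set (Set Ordinal)}
    {p : Set Ordinal × Set Ordinal} (hp : IsCond κ F p) : p.1 ⊆ Set.Iic (sSup p.1) :=
  fun _ hx => le_csSup ⟨κ, fun _ hy => (hp.2.1 hy).le⟩ hx

/-- Two conditions with the same closed bounded part have a common extension, obtained by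
intersecting their second coordinates. -/
theorem IsCond.exists_common_ext {κ : Ordinal} {F : Set (Set Ordinal)}
    (hFint : ∀ A ∈ F, ∀ B ∈ F, A ∩ B ∈ F) {c A B : Set Ordinal}
    (hA : IsCond κ F (c, A)) (hB : IsCond κ F (c, B)) :
    ∃ r, IsCond κ F r ∧ CondExt (c, A) r ∧ CondExt (c, B) r := by
  have hc : c ∩ Set.Iic (sSup c) = c := Set.inter_eq_left.2 hA.subset_Iic_sSup
  refine ⟨(c, A ∩ B), ?_, ⟨hc, Set.inter_subset_left, ?_⟩, ⟨hc, Set.inter_subset_right, ?_⟩⟩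
  · exact ⟨hA.1, hA.2.1, hA.2.2.1, hA.2.2.2.1, hFint _ hA.2.2.2.2 _ hB.2.2.2.2⟩
  all_goals simp

/-- Let `κ` be a regular uncountable cardinal with `2^λ ≤ κ` for every cardinal `λ < κ`, and
let `F` be a proper filter on `κ`. Then any two conditions of `C_F` with the same closed
bounded part are compatible, and every antichain of `C_F` has cardinality at most `κ`
(i.e. it injects into `κ`): `C_F` satisfies the `κ⁺`-chain condition. -/
theorem clubShooting_kappaPlus_cc
    (κ : Ordinal) (hcard : κ.card.ord = κ) (hreg : κ.card.IsRegular)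
    (hunc : Cardinal.aleph0 < κ.card)
    (hpow : ∀ lam : Cardinal, lam < κ.card → 2 ^ lam ≤ κ.card)
    (F : Set (Set Ordinal))
    (hFsub : ∀ A ∈ F, A ⊆ Set.Iio κ)
    (hFuniv : Set.Iio κ ∈ F)
    (hFup : ∀ A ∈ F, ∀ B, A ⊆ B → B ⊆ Set.Iio κ → B ∈ F)
    (hFint : ∀ A ∈ F, ∀ B ∈ F, A ∩ B ∈ F)
    (hFproper : (∅ : Set Ordinal) ∉ F) :
    (∀ c A B : Set Ordinal, IsCond κ F (c, A) → IsCond κ F (c, B) →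
      ∃ r, IsCond κ F r ∧ CondExt (c, A) r ∧ CondExt (c, B) r) ∧
    (∀ S : Set (Set Ordinal × Set Ordinal), (∀ p ∈ S, IsCond κ F p) →
      (∀ p ∈ S, ∀ q ∈ S, p ≠ q → ¬ ∃ r, IsCond κ F r ∧ CondExt p r ∧ CondExt q r) →
      ∃ f : S → Set.Iio κ, Function.Injective f) := by
  refine ⟨fun c A B hA hB => hA.exists_common_ext hFint hB, fun S hS hanti => ?_⟩
  have hpos : 0 < κ := pos_iff_ne_zero.2 (by rintro rfl; simp at hunc)
  have : Nonempty (Set.Iio κ) := ⟨⟨0, hpos⟩⟩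
  choose! g hg using fun (α : Ordinal) (hα : α < κ) =>
    exists_injective_set_Iic hcard hunc.le hpow hα
  have hprod : Cardinal.mk (Set.Iio κ × Set.Iio κ) ≤ Cardinal.mk (Set.Iio κ) := by
    rw [← Cardinal.mul_def, Cardinal.mul_eq_self]
    rw [Cardinal.mk_Iio_ordinal, Cardinal.aleph0_le_lift]
    exact hunc.le
  obtain ⟨e⟩ := hprod
  refine ⟨fun p => e (⟨sSup p.1.1, (hS p.1 p.2).2.2.1⟩, g (sSup p.1.1) (Subtype.val ⁻¹' p.1.1)), ?_⟩
  rintro ⟨⟨c, A⟩, hp⟩ ⟨⟨d, B⟩, hq⟩ h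
  obtain ⟨hsup, hcode⟩ := Prod.ext_iff.1 (e.injective h)
  have hsup' : sSup c = sSup d := congrArg Subtype.val hsup
  have hcd : c = d := by
    have hc := (hS _ hp).subset_Iic_sSup
    have hd := (hS _ hq).subset_Iic_sSup
    simp only at hc hd hcode
    rw [← hsup'] at hcode hd
    have hpre := hg _ (hS _ hp).2.2.1 hcode
    rw [← Set.inter_eq_right.2 hc, ← Set.inter_eq_right.2 hd]
    exact Subtype.preimage_val_eq_preimage_val_iff _ _ _ |>.1 hpre
  subst hcd
  by_contra hne
  exact hanti _ hp _ hq (fun heq => hne (Subtype.ext heq))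
    ((hS _ hp).exists_common_ext hFint (hS _ hq))
end
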